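/- Let K, L ⊆ ℝ² be convex bodies in the plane and let λ ∈ (0,1). Then W((1−λ)K + λL)^{1/3} ≥ (1−λ)·W(K)^{1/3} + λ·W(L)^{1/3}; i.e., in dimension n = 2 the Wills functional is (1/3)-concave with respect to Minkowski combinations. -/

import Mathlib

open scoped Pointwise
open MeasureTheory Metric Real

/-- The Wills functional `W(K) = ∫_{ℝⁿ} e^{-π d(x,K)²} dx`. -/
noncomputable def wills {n : ℕ} (K : Set (EuclideanSpace ℝ (Fin n))) : ℝ :=
  ∫ x, Real.exp (-π * (Metric.infDist x K) ^ 2)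

/-- `p` is the nearest point map of `K`. -/
def IsProj (K : Set (EuclideanSpace ℝ (Fin 2)))
    (p : EuclideanSpace ℝ (Fin 2) → EuclideanSpace ℝ (Fin 2)) : Prop :=
  ∀ x, p x ∈ K ∧ ∀ w ∈ K, inner ℝ (x - p x) (w - p x) ≤ 0

theorem exists_isProj {K : Set (EuclideanSpace ℝ (Fin 2))}
    (h1 : IsCompact K) (h2 : Convex ℝ K) (h3 : K.Nonempty) : ∃ p, IsProj K p := by
  have := exists_norm_eq_iInf_of_complete_convex h3 h1.isComplete h2
  choose p hp hq using this
  exact ⟨p, fun x => ⟨hp x, (norm_eq_iInf_iff_real_inner_le_zero h2 (hp x)).1 (hq x)⟩⟩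

section
variable {K : Set (EuclideanSpace ℝ (Fin 2))}
  {p : EuclideanSpace ℝ (Fin 2) → EuclideanSpace ℝ (Fin 2)}

theorem IsProj.firm (hp : IsProj K p) (x y : EuclideanSpace ℝ (Fin 2)) :
    ‖p x - p y‖ ^ 2 ≤ inner ℝ (p x - p y) (x - y) := by
  have h1 := (hp x).2 (p y) (hp y).1
  have h2 := (hp y).2 (p x) (hp x).1
  rw [← real_inner_self_eq_norm_sq]
  simp only [inner_sub_left, inner_sub_right] at *
  have := real_inner_comm x (p x)
  have := real_inner_comm x (p y)
  have := real_inner_comm y (p x)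
  have := real_inner_comm y (p y)
  have := real_inner_comm (p x) (p y)
  linarith

theorem IsProj.lip (hp : IsProj K p) : LipschitzWith 1 p := by
  refine LipschitzWith.of_dist_le_mul fun x y => ?_
  rw [dist_eq_norm, dist_eq_norm]
  have h := hp.firm x y
  have h2 := real_inner_le_norm (p x - p y) (x - y)
  simp only [NNReal.coe_one, one_mul]
  by_contra hc
  push Not at hc
  nlinarith [norm_nonneg (x - y), norm_nonneg (p x - p y)]

theorem IsProj.unique (hp : IsProj K p) {x q : EuclideanSpace ℝ (Fin 2)} (hq : q ∈ K)
    (h : ∀ w ∈ K, inner ℝ (x - q) (w - q) ≤ 0) : p x = q := by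
  have h1 := (hp x).2 q hq
  have h2 := h (p x) (hp x).1
  have : ‖p x - q‖ ^ 2 ≤ 0 := by
    rw [← real_inner_self_eq_norm_sq]
    simp only [inner_sub_left, inner_sub_right] at *
    have := real_inner_comm q (p x)
    linarith
  have h3 : ‖p x - q‖ = 0 := by nlinarith [norm_nonneg (p x - q)]
  exact sub_eq_zero.1 (norm_eq_zero.1 h3)

theorem IsProj.infDist (hp : IsProj K p) (x : EuclideanSpace ℝ (Fin 2)) :
    Metric.infDist x K = ‖x - p x‖ := by
  apply le_antisymm
  · rw [← dist_eq_norm]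
    exact Metric.infDist_le_dist_of_mem (hp x).1
  · rw [Metric.le_infDist ⟨_, (hp x).1⟩]
    intro w hw
    rw [dist_eq_norm]
    have h := (hp x).2 w hw
    have e : x - w = (x - p x) - (w - p x) := by abel
    have h2 := @norm_sub_sq_real _ _ _ (x - p x) (w - p x)
    rw [← e] at h2
    apply le_of_sq_le_sq _ (norm_nonneg _)
    nlinarith [sq_nonneg ‖w - p x‖]

theorem IsProj.move (hp : IsProj K p) (x : EuclideanSpace ℝ (Fin 2)) {s : ℝ} (hs : 0 ≤ s) :
    p (p x + s • (x - p x)) = p x := by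
  apply hp.unique (hp x).1
  intro w hw
  rw [add_sub_cancel_left, inner_smul_left]
  exact mul_nonpos_of_nonneg_of_nonpos hs ((hp x).2 w hw)

theorem IsProj.deriv_nonneg (hp : IsProj K p) {x : EuclideanSpace ℝ (Fin 2)}
    {D : EuclideanSpace ℝ (Fin 2) →L[ℝ] EuclideanSpace ℝ (Fin 2)} (hD : HasFDerivAt p D x)
    (v : EuclideanSpace ℝ (Fin 2)) : 0 ≤ inner ℝ (D v) v := by
  have h1 : HasDerivAt (fun t : ℝ => x + t • v) v 0 := by
    simpa using ((hasDerivAt_id (0:ℝ)).smul_const v).const_add x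
  have h2 : HasDerivAt (fun t : ℝ => p (x + t • v)) (D v) 0 := by
    have : HasFDerivAt p D (x + (0:ℝ) • v) := by simpa using hD
    exact this.comp_hasDerivAt (0:ℝ) h1
  have h3 := hasDerivAt_iff_tendsto_slope.1 h2
  have h4 : Filter.Tendsto (fun t => inner ℝ (slope (fun t : ℝ => p (x + t • v)) 0 t) v)
      (nhdsWithin 0 {0}ᶜ) (nhds (inner ℝ (D v) v)) := h3.inner tendsto_const_nhds
  refine ge_of_tendsto h4 ?_
  filter_upwards [self_mem_nhdsWithin] with t ht
  have h5 := hp.firm (x + t • v) x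
  have ht : t ≠ 0 := ht
  simp only [slope_def_module, sub_zero, zero_smul, add_zero, inner_smul_left]
  rw [add_sub_cancel_left, inner_smul_right] at h5
  have h6 : 0 ≤ t * inner ℝ (p (x + t • v) - p x) v := le_trans (sq_nonneg _) h5
  have : (starRingEnd ℝ) t⁻¹ * inner ℝ (p (x + t • v) - p x) v
      = (t * inner ℝ (p (x + t • v) - p x) v) / t ^ 2 := by
    simp; field_simp
  rw [this]; positivity

theorem IsProj.deriv_radial (hp : IsProj K p) {x : EuclideanSpace ℝ (Fin 2)}
    {D : EuclideanSpace ℝ (Fin 2) →L[ℝ] EuclideanSpace ℝ (Fin 2)} (hD : HasFDerivAt p D x) :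
    D (x - p x) = 0 := by
  have h1 : HasDerivAt (fun t : ℝ => p x + t • (x - p x)) (x - p x) 1 := by
    simpa using ((hasDerivAt_id (1:ℝ)).smul_const (x - p x)).const_add (p x)
  have h2 : HasDerivAt (fun t : ℝ => p (p x + t • (x - p x))) (D (x - p x)) 1 := by
    have : HasFDerivAt p D (p x + (1:ℝ) • (x - p x)) := by simpa using hD
    exact this.comp_hasDerivAt (1:ℝ) h1
  have h3 : HasDerivAt (fun t : ℝ => p (p x + t • (x - p x))) 0 1 := by
    apply (hasDerivAt_const (1:ℝ) (p x)).congr_of_eventuallyEq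
    filter_upwards [lt_mem_nhds (zero_lt_one' ℝ)] with t ht
    exact hp.move x ht.le
  exact h2.unique h3

/-- the trace of a planar linear map, in coordinates -/
noncomputable def tr2 (D : EuclideanSpace ℝ (Fin 2) →L[ℝ] EuclideanSpace ℝ (Fin 2)) : ℝ :=
  inner ℝ (D (EuclideanSpace.single 0 1)) (EuclideanSpace.single 0 1) +
  inner ℝ (D (EuclideanSpace.single 1 1)) (EuclideanSpace.single 1 1)

theorem det_formula (D : EuclideanSpace ℝ (Fin 2) →L[ℝ] EuclideanSpace ℝ (Fin 2))
    {v : EuclideanSpace ℝ (Fin 2)} (hv : v ≠ 0) (hD : D v = 0) (s : ℝ) :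
    (D + s • (ContinuousLinearMap.id ℝ _ - D)).det = s ^ 2 + s * (1 - s) * tr2 D := by
  have key : ∀ F : EuclideanSpace ℝ (Fin 2) →L[ℝ] EuclideanSpace ℝ (Fin 2),
      F.det = F (EuclideanSpace.single 0 1) 0 * F (EuclideanSpace.single 1 1) 1
        - F (EuclideanSpace.single 1 1) 0 * F (EuclideanSpace.single 0 1) 1 := by
    intro F
    rw [ContinuousLinearMap.det, ← LinearMap.det_toMatrix
      (EuclideanSpace.basisFun (Fin 2) ℝ).toBasis, Matrix.det_fin_two]
    simp [LinearMap.toMatrix_apply]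
  have h0 : D.det = 0 := by
    by_contra h
    have : Function.Injective D := by
      have := (LinearMap.equivOfDetNeZero (D : EuclideanSpace ℝ (Fin 2) →ₗ[ℝ] _) h).injective
      exact this
    exact hv (this (by simpa using hD))
  rw [key] at h0 ⊢
  simp [tr2, EuclideanSpace.inner_single_right]
  linear_combination (1 - s) ^ 2 * h0

end

section
variable {K : Set (EuclideanSpace ℝ (Fin 2))}
  {p : EuclideanSpace ℝ (Fin 2) → EuclideanSpace ℝ (Fin 2)}

theorem volume_image_null {f : EuclideanSpace ℝ (Fin 2) → EuclideanSpace ℝ (Fin 2)}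
    {C : NNReal} (hf : LipschitzWith C f) {N : Set (EuclideanSpace ℝ (Fin 2))}
    (hN : volume N = 0) : volume (f '' N) = 0 := by
  have hh : (Measure.hausdorffMeasure 2 : Measure (EuclideanSpace ℝ (Fin 2))).IsAddHaarMeasure := by
    simpa using MeasureTheory.isAddHaarMeasure_hausdorffMeasure (E := EuclideanSpace ℝ (Fin 2))
  have h1 : (Measure.hausdorffMeasure 2 : Measure (EuclideanSpace ℝ (Fin 2))) N = 0 :=
    Measure.absolutelyContinuous_isAddHaarMeasure _ volume hN
  have h2 := hf.hausdorffMeasure_image_le (d := 2) (by norm_num) N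
  rw [h1, mul_zero] at h2
  exact Measure.absolutelyContinuous_isAddHaarMeasure volume (Measure.hausdorffMeasure 2)
    (le_antisymm h2 bot_le)

/-- the outer shell of width `R` -/
def shell (K : Set (EuclideanSpace ℝ (Fin 2))) (R : ℝ) : Set (EuclideanSpace ℝ (Fin 2)) :=
  {x | 0 < Metric.infDist x K ∧ Metric.infDist x K ≤ R}

theorem measurableSet_shell (K : Set (EuclideanSpace ℝ (Fin 2))) (R : ℝ) :
    MeasurableSet (shell K R) := by
  have h : Measurable fun x => Metric.infDist x K := (Metric.continuous_infDist_pt K).measurable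
  exact (measurableSet_lt measurable_const h).inter (measurableSet_le h measurable_const)

theorem IsProj.injective (hp : IsProj K p) {s : ℝ} (hs : 0 < s) :
    Function.Injective fun x => p x + s • (x - p x) := by
  intro x y hxy
  have hxy : p x + s • (x - p x) = p y + s • (y - p y) := hxy
  have h1 : p x = p y := by
    rw [← hp.move x hs.le, hxy, hp.move y hs.le]
  rw [h1] at hxy
  have := smul_right_injective _ hs.ne' (add_left_cancel hxy)
  simpa using this

theorem IsProj.infDist_move (hp : IsProj K p) {s : ℝ} (hs : 0 < s) (x) :
    Metric.infDist (p x + s • (x - p x)) K = s * Metric.infDist x K := by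
  rw [hp.infDist, hp.infDist, hp.move x hs.le, add_sub_cancel_left, norm_smul,
    Real.norm_of_nonneg hs.le]

theorem IsProj.image_shell (hp : IsProj K p) {s : ℝ} (hs : 0 < s) (R : ℝ) :
    (fun x => p x + s • (x - p x)) '' shell K R = shell K (s * R) := by
  ext y
  constructor
  · rintro ⟨x, ⟨h1, h2⟩, rfl⟩
    simp only [shell, Set.mem_ofPred_eq, hp.infDist_move hs]
    exact ⟨mul_pos hs h1, by gcongr⟩
  · rintro ⟨h1, h2⟩
    have hs' : 0 < s⁻¹ := inv_pos.2 hs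
    refine ⟨p y + s⁻¹ • (y - p y), ⟨?_, ?_⟩, ?_⟩
    · rw [hp.infDist_move hs']; positivity
    · rw [hp.infDist_move hs', inv_mul_le_iff₀ hs]; exact h2
    · simp only [hp.move y hs'.le, add_sub_cancel_left]
      rw [smul_smul, mul_inv_cancel₀ hs.ne', one_smul, add_sub_cancel]

theorem IsProj.volume_shell (hp : IsProj K p) (R : ℝ) : ∃ β : ENNReal, ∀ s : ℝ, 0 < s → s ≤ 1 →
    volume (shell K (s * R)) =
      ENNReal.ofReal (s ^ 2) * volume (shell K R) + ENNReal.ofReal (s * (1 - s)) * β := by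
  set G : Set (EuclideanSpace ℝ (Fin 2)) := shell K R ∩ {x | DifferentiableAt ℝ p x} with hG
  have hGm : MeasurableSet G :=
    (measurableSet_shell K R).inter (measurableSet_of_differentiableAt ℝ p)
  have hN : volume {x | DifferentiableAt ℝ p x}ᶜ = 0 := hp.lip.ae_differentiableAt
  have hGv : volume G = volume (shell K R) := by
    rw [hG]; exact measure_inter_conull hN
  refine ⟨∫⁻ x in G, ENNReal.ofReal (tr2 (fderiv ℝ p x)), fun s hs hs1 => ?_⟩
  have hlip : ∃ C, LipschitzWith C (fun x => p x + s • (x - p x)) := by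
    have h1 : LipschitzWith (1 + 1) (fun x => x - p x) := LipschitzWith.id.sub hp.lip
    have h2 : LipschitzWith _ (fun x => s • (x - p x)) := (lipschitzWith_smul s).comp h1
    exact ⟨_, hp.lip.add h2⟩
  obtain ⟨C, hC⟩ := hlip
  have him : volume ((fun x => p x + s • (x - p x)) '' G) = volume (shell K (s * R)) := by
    apply le_antisymm
    · rw [← hp.image_shell hs]
      exact measure_mono (Set.image_mono Set.inter_subset_left)
    · have : shell K (s * R) ⊆ ((fun x => p x + s • (x - p x)) '' G) ∪
          ((fun x => p x + s • (x - p x)) '' {x | DifferentiableAt ℝ p x}ᶜ) := by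
        rw [← hp.image_shell hs, ← Set.image_union]
        apply Set.image_mono
        intro x hx
        by_cases h : DifferentiableAt ℝ p x
        · exact Or.inl ⟨hx, h⟩
        · exact Or.inr h
      refine (measure_mono this).trans ((measure_union_le _ _).trans ?_)
      rw [volume_image_null hC hN, add_zero]
  rw [← him, ← lintegral_abs_det_fderiv_eq_addHaar_image volume hGm
    (f' := fun x => fderiv ℝ p x + s • (ContinuousLinearMap.id ℝ _ - fderiv ℝ p x)) ?_
    (hp.injective hs).injOn]
  · rw [← hGv, ← lintegral_const_mul' _ _ ENNReal.ofReal_ne_top, ← setLIntegral_const,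
      ← lintegral_add_left measurable_const]
    apply setLIntegral_congr_fun hGm
    intro x hx
    have hd := hx.2.hasFDerivAt
    have hx0 : x - p x ≠ 0 := by
      have := hx.1.1
      rw [hp.infDist] at this
      exact norm_pos_iff.1 this
    have htr : 0 ≤ tr2 (fderiv ℝ p x) :=
      add_nonneg (hp.deriv_nonneg hd _) (hp.deriv_nonneg hd _)
    simp only
    have h1s : 0 ≤ s * (1 - s) := mul_nonneg hs.le (by linarith)
    rw [det_formula _ hx0 (hp.deriv_radial hd), abs_of_nonneg (by positivity),
      ENNReal.ofReal_add (by positivity) (by positivity), ENNReal.ofReal_mul h1s]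
  · intro x hx
    have hd := hx.2.hasFDerivAt
    exact (hd.add (((hasFDerivAt_id x).sub hd).const_smul s)).hasFDerivWithinAt

theorem volume_le_ne_top (hK : IsCompact K) (hne : K.Nonempty) (r : ℝ) :
    volume {x | Metric.infDist x K ≤ r} ≠ ⊤ := by
  rcases lt_or_ge r 0 with h | h
  · have : {x | Metric.infDist x K ≤ r} = ∅ := by
      ext x; simp; exact h.trans_le Metric.infDist_nonneg
    simp [this]
  · obtain ⟨D, hD⟩ := hK.isBounded.subset_closedBall 0
    refine ne_top_of_le_ne_top (measure_closedBall_lt_top (x := 0) (r := D + r + 1)).ne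
      (measure_mono ?_)
    intro x hx
    obtain ⟨y, hy, hxy⟩ := (Metric.infDist_lt_iff hne).1 (lt_of_le_of_lt hx (lt_add_one r))
    have := hD hy
    simp only [mem_closedBall] at *
    linarith [dist_triangle x y 0]

/-- Steiner's formula in the plane. -/
theorem steiner (hK : IsCompact K) (hc : Convex ℝ K) (hne : K.Nonempty) :
    ∃ A b : ℝ, ∀ r : ℝ, 0 < r →
      volume {x | Metric.infDist x K ≤ r} = ENNReal.ofReal (A + b * r + π * r ^ 2) ∧
      0 ≤ A + b * r + π * r ^ 2 := by
  obtain ⟨p, hp⟩ := exists_isProj hK hc hne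
  set v : ℝ → ℝ := fun r => (volume (shell K r)).toReal with hv
  have hfin : ∀ r, volume (shell K r) ≠ ⊤ := fun r =>
    ne_top_of_le_ne_top (volume_le_ne_top hK hne r) (measure_mono fun x hx => hx.2)
  have key : ∀ R : ℝ, ∃ β : ℝ, ∀ s : ℝ, 0 < s → s ≤ 1 →
      v (s * R) = s ^ 2 * v R + s * (1 - s) * β := by
    intro R
    obtain ⟨β, hβ⟩ := hp.volume_shell R
    have hβt : β ≠ ⊤ := by
      rintro rfl
      have := hβ (1/2) (by norm_num) (by norm_num)
      rw [ENNReal.mul_top (by simp; norm_num), add_top] at this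
      exact hfin _ this
    refine ⟨β.toReal, fun s hs hs1 => ?_⟩
    have h1s : 0 ≤ s * (1 - s) := mul_nonneg hs.le (by linarith)
    simp only [hv]
    rw [hβ s hs hs1, ENNReal.toReal_add
      (ENNReal.mul_ne_top ENNReal.ofReal_ne_top (hfin _)) (ENNReal.mul_ne_top ENNReal.ofReal_ne_top hβt),
      ENNReal.toReal_mul, ENNReal.toReal_mul, ENNReal.toReal_ofReal (by positivity),
      ENNReal.toReal_ofReal h1s]
  obtain ⟨b, c, hbc⟩ : ∃ b c : ℝ, ∀ r, 0 < r → v r = b * r + c * r ^ 2 := by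
    obtain ⟨β, hβ⟩ := key 1
    refine ⟨β, v 1 - β, fun r hr => ?_⟩
    rcases le_or_gt r 1 with h | h
    · have := hβ r hr h
      rw [mul_one] at this
      rw [this]; ring
    · obtain ⟨γ, hγ⟩ := key r
      have e1 := hγ (1 / r) (by positivity) (by rw [div_le_one (by positivity)]; exact h.le)
      have e2 := hγ (1 / 2 * (1 / r)) (by positivity) (by
        have : 1 / r ≤ 1 := by rw [div_le_one (by positivity)]; exact h.le
        linarith)
      have e3 := hβ (1 / 2) (by norm_num) (by norm_num)
      have h1 : 1 / r * r = 1 := by field_simp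
      rw [mul_assoc, h1, ← mul_one (1/2 : ℝ), mul_one, mul_one] at e2
      rw [h1] at e1
      rw [mul_one] at e3
      rw [e2] at e3
      have hr' : r ≠ 0 := hr.ne'
      rw [e1] at e3 ⊢
      field_simp at e3 ⊢
      nlinarith
  set A := (volume K).toReal with hA
  have hKt : volume K ≠ ⊤ := hK.measure_lt_top.ne
  have hvol : ∀ r, 0 < r → volume {x | Metric.infDist x K ≤ r} = ENNReal.ofReal (A + v r) := by
    intro r hr
    have : {x | Metric.infDist x K ≤ r} = K ∪ shell K r := by
      ext x
      have hx : x ∈ K ↔ Metric.infDist x K = 0 := hK.isClosed.mem_iff_infDist_zero hne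
      have : 0 ≤ Metric.infDist x K := Metric.infDist_nonneg
      simp only [shell, Set.mem_ofPred_eq, Set.mem_union, hx]
      constructor
      · intro h
        rcases this.eq_or_lt with h' | h'
        · exact Or.inl h'.symm
        · exact Or.inr ⟨h', h⟩
      · rintro (h | h)
        · rw [h]; exact hr.le
        · exact h.2
    rw [this, measure_union _ (measurableSet_shell K r), ENNReal.ofReal_add ENNReal.toReal_nonneg
      ENNReal.toReal_nonneg, ENNReal.ofReal_toReal hKt, ENNReal.ofReal_toReal (hfin r)]
    rw [Set.disjoint_left]
    intro x hx hx2
    have := hx2.1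
    rw [(hK.isClosed.mem_iff_infDist_zero hne).1 hx] at this
    exact lt_irrefl _ this
  have hball : ∀ (x : EuclideanSpace ℝ (Fin 2)) (r : ℝ), 0 ≤ r →
      volume (closedBall x r) = ENNReal.ofReal (π * r ^ 2) := by
    intro x r hr
    rw [EuclideanSpace.volume_closedBall_fin_two]
    rw [ENNReal.ofReal_mul pi_pos.le, ENNReal.ofReal_pow hr, mul_comm]
  obtain ⟨x0, hx0⟩ := hne
  obtain ⟨D, hD⟩ := hK.isBounded.subset_closedBall x0
  have hD0 : 0 ≤ D := by
    have := hD hx0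
    simpa using this
  have hlow : ∀ r, 0 < r → π * r ^ 2 ≤ A + (b * r + c * r ^ 2) := by
    intro r hr
    have h1 : volume (closedBall x0 r) ≤ volume {x | Metric.infDist x K ≤ r} :=
      measure_mono fun x hx => (Metric.infDist_le_dist_of_mem hx0).trans hx
    rw [hball _ _ hr.le, hvol r hr] at h1
    rw [← hbc r hr]
    exact (ENNReal.ofReal_le_ofReal_iff (add_nonneg ENNReal.toReal_nonneg
      ENNReal.toReal_nonneg)).1 h1
  have hup : ∀ r, 0 < r → A + (b * r + c * r ^ 2) ≤ π * (r + D) ^ 2 := by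
    intro r hr
    have h1 : volume {x | Metric.infDist x K ≤ r} ≤ volume (closedBall x0 (r + D)) := by
      refine measure_mono fun x hx => ?_
      have hx : Metric.infDist x K ≤ r := hx
      rw [hp.infDist, ← dist_eq_norm] at hx
      have := hD (hp x).1
      simp only [mem_closedBall] at *
      linarith [dist_triangle x (p x) x0]
    rw [hball _ _ (by positivity), hvol r hr] at h1
    rw [← hbc r hr]
    exact (ENNReal.ofReal_le_ofReal_iff (by positivity)).1 h1
  have quad : ∀ a1 b1 c1 : ℝ, (∀ r : ℝ, 0 < r → 0 ≤ a1 + b1 * r + c1 * r ^ 2) → 0 ≤ c1 := by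
    intro a1 b1 c1 h
    by_contra hneg
    push Not at hneg
    have := h ((|a1| + |b1| + 1) / (-c1) + 1) (by
      have : 0 < -c1 := by linarith
      positivity)
    set t := (|a1| + |b1| + 1) / (-c1) with ht
    have h2 : (-c1) * t = |a1| + |b1| + 1 := by
      rw [ht, mul_div_cancel₀]; exact (by linarith : (0:ℝ) < -c1).ne'
    have ht0 : 0 ≤ t := by
      have : 0 < -c1 := by linarith
      positivity
    have e : c1 * (t + 1) ^ 2 = -(|a1| + |b1| + 1) * (t + 1) + c1 * (t + 1) := by
      rw [← h2]; ring
    have : b1 * (t + 1) ≤ |b1| * (t + 1) := by gcongr; exact le_abs_self _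
    have : a1 ≤ |a1| * (t + 1) := by nlinarith [le_abs_self a1, abs_nonneg a1]
    have : c1 * (t + 1) < 0 := by nlinarith
    nlinarith
  have hcπ : c = π := by
    apply le_antisymm
    · have := quad (π * D ^ 2 - A) (2 * π * D - b) (π - c) fun r hr => by
        nlinarith [hup r hr]
      linarith
    · have := quad A b (c - π) fun r hr => by nlinarith [hlow r hr]
      linarith
  refine ⟨A, b, fun r hr => ?_⟩
  have e : A + b * r + π * r ^ 2 = A + v r := by rw [hbc r hr, hcπ]; ring
  rw [e]
  exact ⟨hvol r hr, add_nonneg ENNReal.toReal_nonneg ENNReal.toReal_nonneg⟩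

end

theorem moment (q : ℕ) : IntegrableOn (fun r : ℝ => r ^ q * exp (-π * r ^ 2)) (Set.Ioi 0) ∧
    ∫ r in Set.Ioi (0:ℝ), r ^ q * exp (-π * r ^ 2) =
      π ^ (-((q:ℝ) + 1) / 2) * (1 / 2) * Real.Gamma (((q:ℝ) + 1) / 2) := by
  have hq : (-1:ℝ) < q := by
    have : (0:ℝ) ≤ q := Nat.cast_nonneg q
    linarith
  constructor
  · have := integrableOn_rpow_mul_exp_neg_mul_sq pi_pos hq
    simpa only [Real.rpow_natCast] using this
  · have := integral_rpow_mul_exp_neg_mul_rpow (two_pos : (0:ℝ) < 2) hq pi_pos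
    simpa only [Real.rpow_natCast, Real.rpow_two] using this

theorem moment1 : ∫ r in Set.Ioi (0:ℝ), r ^ 1 * exp (-π * r ^ 2) = 1 / (2 * π) := by
  rw [(moment 1).2]
  have : (-(((1:ℕ):ℝ) + 1) / 2) = -1 := by norm_num
  rw [this, Real.rpow_neg_one]
  have : ((((1:ℕ):ℝ) + 1) / 2) = 1 := by norm_num
  rw [this, Real.Gamma_one]
  field_simp

theorem moment3 : ∫ r in Set.Ioi (0:ℝ), r ^ 3 * exp (-π * r ^ 2) = 1 / (2 * π ^ 2) := by
  rw [(moment 3).2]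
  have : (-(((3:ℕ):ℝ) + 1) / 2) = -((2:ℕ):ℝ) := by norm_num
  rw [this, Real.rpow_neg pi_pos.le, Real.rpow_natCast]
  have : ((((3:ℕ):ℝ) + 1) / 2) = 2 := by norm_num
  rw [this, Real.Gamma_two]
  field_simp

theorem moment2 : ∫ r in Set.Ioi (0:ℝ), r ^ 2 * exp (-π * r ^ 2) = 1 / (4 * π) := by
  rw [(moment 2).2]
  have : (-(((2:ℕ):ℝ) + 1) / 2) = -1 + (-(1/2)) := by norm_num
  rw [this, Real.rpow_add pi_pos, Real.rpow_neg_one, Real.rpow_neg pi_pos.le, ← Real.sqrt_eq_rpow]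
  have : ((((2:ℕ):ℝ) + 1) / 2) = 1 / 2 + 1 := by norm_num
  rw [this, Real.Gamma_add_one (by norm_num), Real.Gamma_one_half_eq]
  have : Real.sqrt π ≠ 0 := (Real.sqrt_pos.2 pi_pos).ne'
  field_simp
  norm_num

theorem tail_integral {d : ℝ} (hd : 0 ≤ d) :
    ∫⁻ r in Set.Ioi d, ENNReal.ofReal (2 * π * r * exp (-π * r ^ 2)) =
      ENNReal.ofReal (exp (-π * d ^ 2)) := by
  have hder : ∀ x ∈ Set.Ici d, HasDerivAt (fun r : ℝ => - exp (-π * r ^ 2))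
      (2 * π * x * exp (-π * x ^ 2)) x := by
    intro x _
    have h1 : HasDerivAt (fun r : ℝ => -π * r ^ 2) (-π * (2 * x)) x := by
      simpa using (hasDerivAt_pow 2 x).const_mul (-π)
    exact h1.exp.neg.congr_deriv (by ring)
  have hpos : ∀ x ∈ Set.Ioi d, 0 ≤ 2 * π * x * exp (-π * x ^ 2) := by
    intro x hx
    have : 0 ≤ x := hd.trans (le_of_lt hx)
    positivity
  have hlim : Filter.Tendsto (fun r : ℝ => - exp (-π * r ^ 2)) Filter.atTop (nhds 0) := by
    rw [← neg_zero]
    apply Filter.Tendsto.neg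
    apply Real.tendsto_exp_atBot.comp
    exact (Filter.tendsto_pow_atTop two_ne_zero).const_mul_atTop_of_neg (by linarith [pi_pos])
  have h1 := integral_Ioi_of_hasDerivAt_of_nonneg' hder hpos hlim
  have h2 := integrableOn_Ioi_deriv_of_nonneg' hder hpos hlim
  rw [← ofReal_integral_eq_lintegral_ofReal h2, h1]
  · simp
  · filter_upwards [ae_restrict_mem measurableSet_Ioi] with x hx using hpos x hx

theorem wills_of_steiner {K : Set (EuclideanSpace ℝ (Fin 2))} {A b : ℝ}
    (h : ∀ r : ℝ, 0 < r →
      volume {x | Metric.infDist x K ≤ r} = ENNReal.ofReal (A + b * r + π * r ^ 2) ∧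
      0 ≤ A + b * r + π * r ^ 2) : wills K = A + b / 2 + 1 := by
  have hcont : Continuous fun x : EuclideanSpace ℝ (Fin 2) => Metric.infDist x K :=
    Metric.continuous_infDist_pt K
  have hval : 0 ≤ ∫ r in Set.Ioi (0:ℝ), (2 * π * r * exp (-π * r ^ 2)) * (A + b * r + π * r ^ 2) := by
    apply setIntegral_nonneg measurableSet_Ioi
    intro r hr
    have hr : 0 < r := hr
    exact mul_nonneg (by positivity) (h r hr).2
  have e : ∀ r : ℝ, (2 * π * r * exp (-π * r ^ 2)) * (A + b * r + π * r ^ 2) =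
      (2 * π * A) * (r ^ 1 * exp (-π * r ^ 2)) + (2 * π * b) * (r ^ 2 * exp (-π * r ^ 2)) +
      (2 * π ^ 2) * (r ^ 3 * exp (-π * r ^ 2)) := fun r => by ring
  have i1 := (moment 1).1.const_mul (2 * π * A)
  have i2 := (moment 2).1.const_mul (2 * π * b)
  have i3 := (moment 3).1.const_mul (2 * π ^ 2)
  have hint : IntegrableOn (fun r : ℝ => (2 * π * r * exp (-π * r ^ 2)) *
      (A + b * r + π * r ^ 2)) (Set.Ioi 0) := by
    simp_rw [e]
    exact (i1.add i2).add i3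
  have hcalc : ∫ r in Set.Ioi (0:ℝ), (2 * π * r * exp (-π * r ^ 2)) * (A + b * r + π * r ^ 2)
      = A + b / 2 + 1 := by
    simp_rw [e]
    have i12 : Integrable (fun r : ℝ => (2 * π * A) * (r ^ 1 * exp (-π * r ^ 2)) +
      (2 * π * b) * (r ^ 2 * exp (-π * r ^ 2))) (volume.restrict (Set.Ioi 0)) := i1.add i2
    rw [integral_add i12 i3, integral_add i1 i2, integral_const_mul, integral_const_mul,
      integral_const_mul, moment1, moment2, moment3]
    have := pi_pos.ne'
    field_simp
    ring
  have hlin : ∫⁻ x, ENNReal.ofReal (exp (-π * (Metric.infDist x K) ^ 2)) =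
      ENNReal.ofReal (A + b / 2 + 1) := by
    have h1 : ∀ x : EuclideanSpace ℝ (Fin 2),
        ENNReal.ofReal (exp (-π * (Metric.infDist x K) ^ 2)) =
        ∫⁻ r in Set.Ioi (0:ℝ), (Set.Ici (Metric.infDist x K)).indicator
          (fun r => ENNReal.ofReal (2 * π * r * exp (-π * r ^ 2))) r := by
      intro x
      rw [← tail_integral Metric.infDist_nonneg, setLIntegral_indicator measurableSet_Ici]
      apply setLIntegral_congr
      rcases (Metric.infDist_nonneg (x := x) (s := K)).eq_or_lt with h0 | h0
      · rw [← h0]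
        have : Set.Ici (0:ℝ) ∩ Set.Ioi 0 = Set.Ioi 0 :=
          Set.inter_eq_right.2 Set.Ioi_subset_Ici_self
        rw [this]
        exact Filter.EventuallyEq.rfl
      · have : Set.Ici (Metric.infDist x K) ∩ Set.Ioi 0 = Set.Ici (Metric.infDist x K) :=
          Set.inter_eq_left.2 (fun y hy => lt_of_lt_of_le h0 hy)
        rw [this]
        exact Ioi_ae_eq_Ici
    simp_rw [h1]
    have hmeas : Measurable (Function.uncurry fun (x : EuclideanSpace ℝ (Fin 2)) (r : ℝ) =>
        (Set.Ici (Metric.infDist x K)).indicator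
          (fun r => ENNReal.ofReal (2 * π * r * exp (-π * r ^ 2))) r) := by
      have : (Function.uncurry fun (x : EuclideanSpace ℝ (Fin 2)) (r : ℝ) =>
        (Set.Ici (Metric.infDist x K)).indicator
          (fun r => ENNReal.ofReal (2 * π * r * exp (-π * r ^ 2))) r) =
          Set.indicator {z : EuclideanSpace ℝ (Fin 2) × ℝ | Metric.infDist z.1 K ≤ z.2}
            (fun z => ENNReal.ofReal (2 * π * z.2 * exp (-π * z.2 ^ 2))) := by
        ext ⟨x, r⟩
        simp [Set.indicator]
      rw [this]
      apply Measurable.indicator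
      · fun_prop
      · exact measurableSet_le (hcont.measurable.comp measurable_fst) measurable_snd
    rw [lintegral_lintegral_swap hmeas.aemeasurable, ← hcalc,
      ofReal_integral_eq_lintegral_ofReal hint]
    · apply setLIntegral_congr_fun measurableSet_Ioi
      intro r hr
      have hr : 0 < r := hr
      have : ∀ x : EuclideanSpace ℝ (Fin 2), (Set.Ici (Metric.infDist x K)).indicator
          (fun r => ENNReal.ofReal (2 * π * r * exp (-π * r ^ 2))) r =
          {x | Metric.infDist x K ≤ r}.indicator
            (fun _ => ENNReal.ofReal (2 * π * r * exp (-π * r ^ 2))) x := by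
        intro x; simp [Set.indicator]
      simp only [this]
      rw [lintegral_indicator_const (measurableSet_le hcont.measurable measurable_const),
        (h r hr).1, ← ENNReal.ofReal_mul (by positivity)]
    · filter_upwards [ae_restrict_mem measurableSet_Ioi] with r hr
      have hr : 0 < r := hr
      exact mul_nonneg (by positivity) (h r hr).2
  unfold wills
  rw [integral_eq_lintegral_of_nonneg_ae (Filter.Eventually.of_forall fun x => (exp_pos _).le)
    (by fun_prop), hlin, ENNReal.toReal_ofReal]
  rw [← hcalc]; exact hval

theorem bm_line_compact {X Y : Set ℝ} (hX : IsCompact X) (hY : IsCompact Y) (hX0 : X.Nonempty)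
    (hY0 : Y.Nonempty) : volume X + volume Y ≤ volume (X + Y) := by
  set a := sSup X
  set b := sInf Y
  have ha : a ∈ X := hX.sSup_mem hX0
  have hb : b ∈ Y := hY.sInf_mem hY0
  have hXa : ∀ x ∈ X, x ≤ a := fun x hx => le_csSup hX.bddAbove hx
  have hYb : ∀ y ∈ Y, b ≤ y := fun y hy => csInf_le hY.bddBelow hy
  have h1 : volume ((fun x => b + x) '' X) = volume X := by simp
  have h2 : volume ((fun x => a + x) '' Y) = volume Y := by simp
  have hm : MeasurableSet ((fun x => a + x) '' Y) :=
    (hY.image (by fun_prop : Continuous fun x : ℝ => a + x)).measurableSet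
  rw [← h1, ← h2, ← measure_union₀ hm.nullMeasurableSet]
  · apply measure_mono
    rintro z (⟨x, hx, rfl⟩ | ⟨y, hy, rfl⟩)
    · exact ⟨x, hx, b, hb, add_comm _ _⟩
    · exact ⟨a, ha, y, hy, rfl⟩
  · have : ((fun x => b + x) '' X) ∩ ((fun x => a + x) '' Y) ⊆ {a + b} := by
      rintro z ⟨⟨x, hx, rfl⟩, ⟨y, hy, hxy⟩⟩
      have := hXa x hx
      have := hYb y hy
      simp only [Set.mem_singleton_iff] at *
      linarith
    exact measure_mono_null this (by simp)

theorem bm_line {X Y : Set ℝ} (hX : MeasurableSet X) (hY : MeasurableSet Y) (hX0 : X.Nonempty)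
    (hY0 : Y.Nonempty) (hXf : volume X ≠ ⊤) : volume X + volume Y ≤ volume (X + Y) := by
  have tr : ∀ x ∈ X, ∀ Y' ⊆ Y, volume Y' ≤ volume (X + Y) := by
    intro x hx Y' hY'
    have h2 : volume ((fun y => x + y) '' Y') = volume Y' := by simp
    rw [← h2]
    apply measure_mono
    rintro z ⟨y, hy, rfl⟩
    exact ⟨x, hx, y, hY' hy, rfl⟩
  have step1 : ∀ Y' ⊆ Y, IsCompact Y' → Y'.Nonempty → volume X + volume Y' ≤ volume (X + Y) := by
    intro Y' hY' hc hne
    have hfin : volume Y' ≠ ⊤ := hc.measure_lt_top.ne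
    have hle : volume Y' ≤ volume (X + Y) := tr _ hX0.some_mem Y' hY'
    suffices volume X ≤ volume (X + Y) - volume Y' by
      calc _ ≤ volume (X + Y) - volume Y' + volume Y' := by gcongr
        _ = _ := tsub_add_cancel_of_le hle
    rw [hX.measure_eq_iSup_isCompact]
    refine iSup_le fun X' => iSup_le fun hX' => iSup_le fun hc' => ?_
    apply ENNReal.le_sub_of_add_le_right hfin
    rcases X'.eq_empty_or_nonempty with rfl | h
    · simpa using hle
    · exact (bm_line_compact hc' hc h hne).trans (measure_mono (Set.add_subset_add hX' hY'))
  have hle : volume X ≤ volume (X + Y) := by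
    have := step1 {hY0.some} (by simpa using hY0.some_mem) isCompact_singleton (by simp)
    simpa using this
  suffices volume Y ≤ volume (X + Y) - volume X by
    calc _ ≤ volume X + (volume (X + Y) - volume X) := by gcongr
      _ = _ := add_tsub_cancel_of_le hle
  rw [hY.measure_eq_iSup_isCompact]
  refine iSup_le fun X' => iSup_le fun hX' => iSup_le fun hc' => ?_
  apply ENNReal.le_sub_of_add_le_left hXf
  rcases X'.eq_empty_or_nonempty with rfl | h
  · simpa using hle
  · exact step1 _ hX' hc' h

theorem slice_facts {A : Set (ℝ × ℝ)} (hA : IsCompact A) :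
    (∀ x, volume (Prod.mk x ⁻¹' A) ≠ ⊤) ∧
    (BddAbove (Set.range fun x => (volume (Prod.mk x ⁻¹' A)).toReal)) ∧
    (Measurable fun x => (volume (Prod.mk x ⁻¹' A)).toReal) ∧
    (∫⁻ x, ENNReal.ofReal ((volume (Prod.mk x ⁻¹' A)).toReal) = volume A) ∧
    (∀ x, IsCompact (Prod.mk x ⁻¹' A)) ∧
    (∀ x, 0 < (volume (Prod.mk x ⁻¹' A)).toReal → x ∈ Prod.fst '' A) := by
  have hb : ∀ x, volume (Prod.mk x ⁻¹' A) ≤ volume (Prod.snd '' A) := fun x =>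
    measure_mono fun y hy => ⟨(x, y), hy, rfl⟩
  have hf : volume (Prod.snd '' A) ≠ ⊤ := (hA.image continuous_snd).measure_lt_top.ne
  have hf' : ∀ x, volume (Prod.mk x ⁻¹' A) ≠ ⊤ := fun x => ne_top_of_le_ne_top hf (hb x)
  refine ⟨hf', ⟨(volume (Prod.snd '' A)).toReal, ?_⟩, ?_, ?_, ?_, ?_⟩
  · rintro _ ⟨x, rfl⟩
    exact ENNReal.toReal_mono hf (hb x)
  · exact (measurable_measure_prodMk_left hA.measurableSet).ennreal_toReal
  · simp_rw [ENNReal.ofReal_toReal (hf' _)]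
    rw [Measure.volume_eq_prod, Measure.prod_apply hA.measurableSet]
  · intro x
    refine (hA.image continuous_snd).of_isClosed_subset
      (hA.isClosed.preimage (by fun_prop)) fun y hy => ⟨(x, y), hy, rfl⟩
  · intro x hx
    have : (Prod.mk x ⁻¹' A).Nonempty := by
      rw [Set.nonempty_iff_ne_empty]
      intro h
      simp [h] at hx
    obtain ⟨y, hy⟩ := this
    exact ⟨(x, y), hy, rfl⟩

theorem slice_sup_pos {A : Set (ℝ × ℝ)} (hA : IsCompact A) (h0 : volume A ≠ 0) :
    0 < ⨆ x, (volume (Prod.mk x ⁻¹' A)).toReal := by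
  obtain ⟨_, h2, h3, h4, _, _⟩ := slice_facts hA
  by_contra hc
  push Not at hc
  apply h0
  rw [← h4, lintegral_eq_zero_iff' h3.ennreal_ofReal.aemeasurable]
  filter_upwards with x
  simp only [Pi.zero_apply, ENNReal.ofReal_eq_zero]
  exact (le_ciSup h2 x).trans hc

theorem bm_prod {A B : Set (ℝ × ℝ)} (hA : IsCompact A) (hB : IsCompact B)
    (hA0 : volume A ≠ 0) (hB0 : volume B ≠ 0) :
    √(volume A).toReal + √(volume B).toReal ≤ √(volume (A + B)).toReal := by
  have hC : IsCompact (A + B) := hA.add hB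
  obtain ⟨a1, a2, a3, a4, a5, a6⟩ := slice_facts hA
  obtain ⟨b1, b2, b3, b4, b5, b6⟩ := slice_facts hB
  obtain ⟨c1, c2, c3, c4, c5, c6⟩ := slice_facts hC
  have hF := slice_sup_pos hA hA0
  have hG := slice_sup_pos hB hB0
  set f := fun x => (volume (Prod.mk x ⁻¹' A)).toReal with hf
  set g := fun x => (volume (Prod.mk x ⁻¹' B)).toReal with hg
  set h := fun x => (volume (Prod.mk x ⁻¹' (A + B))).toReal with hh
  have hfgh : ∀ x y, 0 < f x → 0 < g y → f x + g y ≤ h (x + y) := by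
    intro x y hx hy
    obtain ⟨⟨_, x'⟩, hx', rfl⟩ := a6 x hx
    obtain ⟨⟨_, y'⟩, hy', rfl⟩ := b6 y hy
    rw [hf, hg, hh]
    simp only
    rw [← ENNReal.toReal_add (a1 _) (b1 _)]
    apply ENNReal.toReal_mono (c1 _)
    refine (bm_line_compact (a5 _) (b5 _) ⟨x', hx'⟩ ⟨y', hy'⟩).trans (measure_mono ?_)
    rintro _ ⟨u, hu, v, hv, rfl⟩
    exact ⟨_, hu, _, hv, rfl⟩
  set F := ⨆ x, f x with hFd
  set G := ⨆ x, g x with hGd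
  have int : ∀ (k : ℝ → ℝ) (c : ℝ) (V : ENNReal), 0 < c → Measurable k → (∀ x, 0 ≤ k x) →
      ∫⁻ x, ENNReal.ofReal (k x) = V →
      ∫⁻ t in Set.Ioi (0:ℝ), volume {x | t < k x / c} = V * ENNReal.ofReal c⁻¹ := by
    intro k c V hc hk hk0 hV
    rw [← lintegral_eq_lintegral_meas_lt volume
      (Filter.Eventually.of_forall fun x => div_nonneg (hk0 x) hc.le) (hk.div_const c).aemeasurable,
      ← hV, ← lintegral_mul_const' _ _ ENNReal.ofReal_ne_top]
    congr with x
    rw [← ENNReal.ofReal_mul (hk0 x), div_eq_mul_inv]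
  have iA := int f F _ hF a3 (fun x => ENNReal.toReal_nonneg) a4
  have iB := int g G _ hG b3 (fun x => ENNReal.toReal_nonneg) b4
  have iC := int h (F + G) _ (add_pos hF hG) c3 (fun x => ENNReal.toReal_nonneg) c4
  have lev : ∀ t ∈ Set.Ioi (0:ℝ), volume {x | t < f x / F} + volume {x | t < g x / G} ≤
      volume {x | t < h x / (F + G)} := by
    intro t ht
    have ht : 0 < t := ht
    rcases lt_or_ge t 1 with h1 | h1
    · have n1 : {x | t < f x / F}.Nonempty := by
        obtain ⟨x, hx⟩ := exists_lt_of_lt_ciSup (show t * F < ⨆ x, f x by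
          rw [← hFd]; nlinarith)
        exact ⟨x, by rw [Set.mem_ofPred_eq, lt_div_iff₀ hF]; exact hx⟩
      have n2 : {x | t < g x / G}.Nonempty := by
        obtain ⟨x, hx⟩ := exists_lt_of_lt_ciSup (show t * G < ⨆ x, g x by
          rw [← hGd]; nlinarith)
        exact ⟨x, by rw [Set.mem_ofPred_eq, lt_div_iff₀ hG]; exact hx⟩
      have fin : volume {x | t < f x / F} ≠ ⊤ := by
        refine ne_top_of_le_ne_top (hA.image continuous_fst).measure_lt_top.ne
          (measure_mono fun x hx => a6 x ?_)
        rw [Set.mem_ofPred_eq, lt_div_iff₀ hF] at hx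
        exact (mul_pos ht hF).trans hx
      refine (bm_line (measurableSet_lt measurable_const (a3.div_const _))
        (measurableSet_lt measurable_const (b3.div_const _)) n1 n2 fin).trans (measure_mono ?_)
      rintro _ ⟨x, hx, y, hy, rfl⟩
      rw [Set.mem_ofPred_eq, lt_div_iff₀ hF] at hx
      rw [Set.mem_ofPred_eq, lt_div_iff₀ hG] at hy
      rw [Set.mem_ofPred_eq, lt_div_iff₀ (add_pos hF hG)]
      have := hfgh x y ((mul_pos ht hF).trans hx) ((mul_pos ht hG).trans hy)
      simp only
      linarith
    · have n1 : {x | t < f x / F} = ∅ := by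
        ext x
        simp only [Set.mem_ofPred_eq, Set.mem_empty_iff_false, iff_false, not_lt]
        exact ((div_le_one hF).2 (le_ciSup a2 x)).trans h1
      have n2 : {x | t < g x / G} = ∅ := by
        ext x
        simp only [Set.mem_ofPred_eq, Set.mem_empty_iff_false, iff_false, not_lt]
        exact ((div_le_one hG).2 (le_ciSup b2 x)).trans h1
      simp [n1, n2]
  have main : volume A * ENNReal.ofReal F⁻¹ + volume B * ENNReal.ofReal G⁻¹ ≤
      volume (A + B) * ENNReal.ofReal (F + G)⁻¹ := by
    rw [← iA, ← iB, ← iC]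
    exact (le_lintegral_add _ _).trans (setLIntegral_mono' measurableSet_Ioi lev)
  have fA : volume A ≠ ⊤ := hA.measure_lt_top.ne
  have fB : volume B ≠ ⊤ := hB.measure_lt_top.ne
  have fC : volume (A + B) ≠ ⊤ := hC.measure_lt_top.ne
  have main2 := ENNReal.toReal_mono (ENNReal.mul_ne_top fC ENNReal.ofReal_ne_top) main
  rw [ENNReal.toReal_add (ENNReal.mul_ne_top fA ENNReal.ofReal_ne_top)
    (ENNReal.mul_ne_top fB ENNReal.ofReal_ne_top), ENNReal.toReal_mul, ENNReal.toReal_mul,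
    ENNReal.toReal_mul, ENNReal.toReal_ofReal (by positivity), ENNReal.toReal_ofReal (by positivity),
    ENNReal.toReal_ofReal (by positivity)] at main2
  have ha : 0 ≤ (volume A).toReal := ENNReal.toReal_nonneg
  have hb : 0 ≤ (volume B).toReal := ENNReal.toReal_nonneg
  generalize (volume A).toReal = a at *
  generalize (volume B).toReal = b at *
  generalize (volume (A + B)).toReal = c at *
  apply Real.le_sqrt_of_sq_le
  have e1 := Real.sq_sqrt ha
  have e2 := Real.sq_sqrt hb
  set u := √a
  set v := √b
  have h3 : (a * F⁻¹ + b * G⁻¹) * (F + G) ≤ c := by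
    rw [← div_eq_mul_inv c, le_div_iff₀ (add_pos hF hG)] at main2
    exact main2
  refine le_trans ?_ h3
  rw [← e1, ← e2]
  have : (u ^ 2 * F⁻¹ + v ^ 2 * G⁻¹) * (F + G) = (u + v) ^ 2 + (u * G - v * F) ^ 2 / (F * G) := by
    field_simp
    ring
  rw [this]
  have : 0 ≤ (u * G - v * F) ^ 2 / (F * G) := by positivity
  linarith

theorem bm_plane {A B : Set (EuclideanSpace ℝ (Fin 2))} (hA : IsCompact A) (hB : IsCompact B)
    (hA0 : volume A ≠ 0) (hB0 : volume B ≠ 0) :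
    √(volume A).toReal + √(volume B).toReal ≤ √(volume (A + B)).toReal := by
  let e : EuclideanSpace ℝ (Fin 2) →+ ℝ × ℝ :=
    { toFun := fun x => (x 0, x 1), map_zero' := rfl, map_add' := fun x y => rfl }
  have hec : Continuous e := by
    show Continuous fun x : EuclideanSpace ℝ (Fin 2) => (x 0, x 1)
    fun_prop
  have hei : Function.Injective e := by
    intro x y hxy
    have h1 : (x 0, x 1) = (y 0, y 1) := hxy
    ext i
    fin_cases i
    · exact (Prod.ext_iff.1 h1).1
    · exact (Prod.ext_iff.1 h1).2
  have hmp : MeasurePreserving e := by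
    have := (volume_preserving_finTwoArrow ℝ).comp (PiLp.volume_preserving_ofLp (Fin 2))
    exact this
  have hv : ∀ S : Set (EuclideanSpace ℝ (Fin 2)), IsCompact S → volume (e '' S) = volume S := by
    intro S hS
    rw [← hmp.measure_preimage (hS.image hec).measurableSet.nullMeasurableSet,
      Set.preimage_image_eq _ hei]
  have := bm_prod (hA.image hec) (hB.image hec) (by rwa [hv A hA]) (by rwa [hv B hB])
  rw [← Set.image_add e, hv _ hA, hv _ hB, hv _ (hA.add hB)] at this
  exact this

theorem tangent_ineq {x y u v c : ℝ} (hx : 1 ≤ x) (hy : 1 ≤ y) (hc0 : 0 ≤ c) (hc : c ≤ 1 / 4)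
    (hu : 0 ≤ u) (hv : 0 ≤ v) (hu2 : u ^ 2 = x ^ 3 - c) (hv2 : v ^ 2 = y ^ 3 - c) :
    3 * x ^ 2 * y - x ^ 3 ≤ 2 * (u * v) + 2 * c := by
  have huv : 0 ≤ u * v := mul_nonneg hu hv
  rcases le_or_gt (3 * x ^ 2 * y - x ^ 3) (2 * c) with h | h
  · linarith
  have h3y : x ≤ 3 * y := by
    by_contra hh
    push Not at hh
    nlinarith [mul_pos (pow_pos (by linarith : (0:ℝ) < x) 2) (sub_pos.2 hh)]
  have hx3 : 3 * (x - 1) ≤ x ^ 3 - 1 := by nlinarith [mul_nonneg (sq_nonneg (x - 1)) (by linarith : 0 ≤ x + 2)]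
  have hmain : y + 2 * x ≤ x ^ 3 * (4 * y - x) := by
    have h1 : 3 * (x - 1) ≤ (4 * y - x) * (x ^ 3 - 1) := by
      have : 1 ≤ 4 * y - x := by linarith
      nlinarith
    nlinarith
  have hm2 : 4 * c * (y + 2 * x) ≤ x ^ 3 * (4 * y - x) := by nlinarith
  have hD : (3 * x ^ 2 * y - x ^ 3 - 2 * c) ^ 2 ≤ (2 * (u * v)) ^ 2 := by
    have e : (2 * (u * v)) ^ 2 = 4 * (x ^ 3 - c) * (y ^ 3 - c) := by
      rw [← hu2, ← hv2]; ring
    rw [e]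
    have : 4 * (x ^ 3 - c) * (y ^ 3 - c) - (3 * x ^ 2 * y - x ^ 3 - 2 * c) ^ 2 =
      (y - x) ^ 2 * (x ^ 3 * (4 * y - x) - 4 * c * (y + 2 * x)) := by ring
    have := mul_nonneg (sq_nonneg (y - x)) (sub_nonneg.2 hm2)
    linarith
  have := le_of_sq_le_sq hD (by positivity)
  linarith

theorem final_ineq {l fK fL fM : ℝ} (hl0 : 0 ≤ l) (hl1 : l ≤ 1) (hK : π / 4 ≤ fK)
    (hL : π / 4 ≤ fL) (hM : (1 - l) * √fK + l * √fL ≤ √fM) (hM0 : 0 ≤ fM) :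
    (1 - l) * (fK + (1 - π / 4)) ^ ((1:ℝ) / 3) + l * (fL + (1 - π / 4)) ^ ((1:ℝ) / 3) ≤
      (fM + (1 - π / 4)) ^ ((1:ℝ) / 3) := by
  have hπ := pi_gt_three
  have hπ4 := pi_le_four
  set c := 1 - π / 4 with hc
  have cube : ∀ w : ℝ, 1 ≤ w → 1 ≤ w ^ ((1:ℝ) / 3) ∧ (w ^ ((1:ℝ) / 3)) ^ 3 = w := by
    intro w hw
    refine ⟨Real.one_le_rpow hw (by norm_num), ?_⟩
    rw [← Real.rpow_natCast, ← Real.rpow_mul (by linarith)]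
    norm_num
  obtain ⟨x1, x3⟩ := cube (fK + c) (by linarith)
  obtain ⟨y1, y3⟩ := cube (fL + c) (by linarith)
  have u2 := Real.sq_sqrt (by linarith : 0 ≤ fK)
  have v2 := Real.sq_sqrt (by linarith : 0 ≤ fL)
  have w2 := Real.sq_sqrt hM0
  have hu := Real.sqrt_nonneg fK
  have hv := Real.sqrt_nonneg fL
  set x := (fK + c) ^ ((1:ℝ) / 3)
  set y := (fL + c) ^ ((1:ℝ) / 3)
  set u := √fK
  set v := √fL
  have t1 := tangent_ineq (c := c) x1 y1 (by linarith) (by linarith) hu hv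
    (by linarith) (by linarith)
  have t2 := tangent_ineq (c := c) y1 x1 (by linarith) (by linarith) hv hu
    (by linarith) (by linarith)
  have hl1' : 0 ≤ 1 - l := by linarith
  have hw : ((1 - l) * u + l * v) ^ 2 ≤ fM := by
    rw [← w2]; gcongr
  have hz : ((1 - l) * x + l * y) ^ 3 ≤ fM + c := by
    have s1 := mul_le_mul_of_nonneg_left t1 (mul_nonneg (mul_nonneg hl0 hl1') hl1')
    have s2 := mul_le_mul_of_nonneg_left t2 (mul_nonneg (mul_nonneg hl0 hl1') hl0)
    have e1 : ((1 - l) * u + l * v) ^ 2 =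
      (1 - l) ^ 2 * (x ^ 3 - c) + l ^ 2 * (y ^ 3 - c) + 2 * l * (1 - l) * (u * v) := by
      have : x ^ 3 - c = u ^ 2 := by linarith
      rw [this]
      have : y ^ 3 - c = v ^ 2 := by linarith
      rw [this]; ring
    nlinarith
  have hz0 : 0 ≤ (1 - l) * x + l * y := by positivity
  calc (1 - l) * x + l * y = (((1 - l) * x + l * y) ^ 3) ^ ((1:ℝ) / 3) := by
        rw [← Real.rpow_natCast, ← Real.rpow_mul hz0]; norm_num
    _ ≤ _ := Real.rpow_le_rpow (by positivity) hz (by norm_num)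

/-- `W(K) = |K + B/2| + 1 - π/4`, with `|K + B/2| ≥ π/4`. -/
theorem wills_eq {K : Set (EuclideanSpace ℝ (Fin 2))}
    (h1 : IsCompact K) (h2 : Convex ℝ K) (h3 : K.Nonempty) :
    wills K = (volume {x | Metric.infDist x K ≤ 1 / 2}).toReal + (1 - π / 4) ∧
    π / 4 ≤ (volume {x | Metric.infDist x K ≤ 1 / 2}).toReal := by
  obtain ⟨A, b, h⟩ := steiner h1 h2 h3
  constructor
  · rw [wills_of_steiner h, (h (1/2) (by norm_num)).1,
      ENNReal.toReal_ofReal (h (1/2) (by norm_num)).2]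
    ring
  · obtain ⟨x0, hx0⟩ := h3
    have hle : volume (closedBall x0 (1/2)) ≤ volume {x | Metric.infDist x K ≤ 1 / 2} :=
      measure_mono fun x hx => (Metric.infDist_le_dist_of_mem hx0).trans hx
    have := ENNReal.toReal_mono (volume_le_ne_top h1 ⟨x0, hx0⟩ _) hle
    refine le_trans (le_of_eq ?_) this
    rw [EuclideanSpace.volume_closedBall_fin_two, ENNReal.toReal_mul, ENNReal.toReal_pow,
      ENNReal.toReal_ofReal (by norm_num), ENNReal.toReal_ofReal pi_pos.le]
    ring

theorem isCompact_half {K : Set (EuclideanSpace ℝ (Fin 2))}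
    (h1 : IsCompact K) (h3 : K.Nonempty) : IsCompact {x | Metric.infDist x K ≤ 1 / 2} := by
  apply Metric.isCompact_of_isClosed_isBounded
  · exact isClosed_le (Metric.continuous_infDist_pt K) continuous_const
  · obtain ⟨D, hD⟩ := h1.isBounded.subset_closedBall 0
    refine (isBounded_closedBall (x := 0) (r := D + 1)).subset ?_
    intro x hx
    obtain ⟨y, hy, hxy⟩ := (Metric.infDist_lt_iff h3 (r := 1)).1 (lt_of_le_of_lt hx (by norm_num))
    have := hD hy
    simp only [mem_closedBall] at *
    linarith [dist_triangle x y 0]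

/-- In the plane the Wills functional is `(1/3)`-concave:
for convex bodies `K, L ⊆ ℝ²` and `λ ∈ (0,1)`,
`W((1-λ)K + λL)^{1/3} ≥ (1-λ) W(K)^{1/3} + λ W(L)^{1/3}`. -/
theorem wills_planar_third_concave (K L : Set (EuclideanSpace ℝ (Fin 2)))
    (hK₁ : IsCompact K) (hK₂ : Convex ℝ K) (hK₃ : K.Nonempty)
    (hL₁ : IsCompact L) (hL₂ : Convex ℝ L) (hL₃ : L.Nonempty)
    {l : ℝ} (hl : l ∈ Set.Ioo (0 : ℝ) 1) :
    wills ((1 - l) • K + l • L) ^ ((1 : ℝ) / 3) ≥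
      (1 - l) * wills K ^ ((1 : ℝ) / 3) + l * wills L ^ ((1 : ℝ) / 3) := by
  obtain ⟨hl0, hl1⟩ := hl
  have hl1' : 0 < 1 - l := by linarith
  have hM₁ : IsCompact ((1 - l) • K + l • L) := (hK₁.smul _).add (hL₁.smul _)
  have hM₂ : Convex ℝ ((1 - l) • K + l • L) := (hK₂.smul _).add (hL₂.smul _)
  have hM₃ : ((1 - l) • K + l • L).Nonempty := (hK₃.smul_set).add (hL₃.smul_set)
  obtain ⟨eK, pK⟩ := wills_eq hK₁ hK₂ hK₃
  obtain ⟨eL, pL⟩ := wills_eq hL₁ hL₂ hL₃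
  obtain ⟨eM, pM⟩ := wills_eq hM₁ hM₂ hM₃
  have hπ := pi_pos
  rw [eK, eL, eM, ge_iff_le]
  refine final_ineq hl0.le hl1.le pK pL ?_ (by linarith)
  have cK := isCompact_half hK₁ hK₃
  have cL := isCompact_half hL₁ hL₃
  have nM := volume_le_ne_top hM₁ hM₃ (1/2)
  have sub : (1 - l) • {x | Metric.infDist x K ≤ 1 / 2} + l • {x | Metric.infDist x L ≤ 1 / 2} ⊆
      {x | Metric.infDist x ((1 - l) • K + l • L) ≤ 1 / 2} := by
    obtain ⟨p, hp⟩ := exists_isProj hK₁ hK₂ hK₃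
    obtain ⟨q, hq⟩ := exists_isProj hL₁ hL₂ hL₃
    rintro _ ⟨_, ⟨x, hx, rfl⟩, _, ⟨y, hy, rfl⟩, rfl⟩
    simp only [Set.mem_ofPred_eq, hp.infDist, hq.infDist] at hx hy ⊢
    have hmem : (1 - l) • p x + l • q y ∈ (1 - l) • K + l • L :=
      Set.add_mem_add (Set.smul_mem_smul_set (hp x).1) (Set.smul_mem_smul_set (hq y).1)
    refine (Metric.infDist_le_dist_of_mem hmem).trans ?_
    rw [dist_eq_norm]
    have e : (1 - l) • x + l • y - ((1 - l) • p x + l • q y) =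
      (1 - l) • (x - p x) + l • (y - q y) := by
      rw [smul_sub, smul_sub]; abel
    rw [e]
    refine (norm_add_le _ _).trans ?_
    rw [norm_smul, norm_smul, Real.norm_of_nonneg hl1'.le, Real.norm_of_nonneg hl0.le]
    nlinarith
  have sc : ∀ (S : Set (EuclideanSpace ℝ (Fin 2))) (r : ℝ), 0 < r →
      √(volume (r • S)).toReal = r * √(volume S).toReal := by
    intro S r hr
    rw [Measure.addHaar_smul, ENNReal.toReal_mul, ENNReal.toReal_ofReal (abs_nonneg _)]
    simp only [finrank_euclideanSpace, Fintype.card_fin, abs_pow]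
    rw [Real.sqrt_mul (by positivity), Real.sqrt_sq (abs_nonneg r), abs_of_pos hr]
  have nz : ∀ (S : Set (EuclideanSpace ℝ (Fin 2))) (r : ℝ), 0 < r → π / 4 ≤ (volume S).toReal →
      volume (r • S) ≠ 0 := by
    intro S r hr hS h0
    have := sc S r hr
    rw [h0, ENNReal.toReal_zero, Real.sqrt_zero] at this
    have : 0 < √(volume S).toReal := Real.sqrt_pos.2 (by linarith)
    nlinarith
  have bm := bm_plane (cK.smul (1 - l)) (cL.smul l) (nz _ _ hl1' pK) (nz _ _ hl0 pL)
  rw [sc _ _ hl1', sc _ _ hl0] at bm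
  exact bm.trans (Real.sqrt_le_sqrt (ENNReal.toReal_mono nM (measure_mono sub)))
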